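/- Rapid mixing for weak local spectral expanders (Alev–Lau). Let (X,w) be a pure d-dimensional weighted simplicial complex, let 1 ≤ k ≤ d, and let γ_{−1}, γ_0, …, γ_{k−2} ∈ [0,1) be such that for every i ∈ {−1,0,…,k−2} and every face τ ∈ X(i), λ₂(A_τ) ≤ γ_i. Then λ₂(W⁻_k) ≤ 1 − ( ∏_{i=−1}^{k−2} (1−γ_i) ) / (k+1); that is, for every f : X(k) → ℝ with ∑_{σ∈X(k)} w(σ) f(σ) = 0, ∑_{σ∈X(k)} w(σ) (W⁻_k f)(σ) f(σ) ≤ ( 1 − (∏_{i=−1}^{k−2}(1−γ_i))/(k+1) ) · ∑_{σ∈X(k)} w(σ) f(σ)². -/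

import Mathlib

open Finset

/-- The vertices of the link of a face `τ`. -/
def linkVerts {V : Type*} [Fintype V] [DecidableEq V]
    (X : Finset (Finset V)) (τ : Finset V) : Finset V :=
  Finset.univ.filter fun v => v ∉ τ ∧ insert v τ ∈ X

/-- `λ₂(A_τ) ≤ γ` for the link random-walk matrix
`A_τ(v,x) = w(τ∪{v,x}) / ((|τ|+2)·w(τ∪{v}))`. -/
def lamTwoLe {V : Type*} [Fintype V] [DecidableEq V]
    (X : Finset (Finset V)) (w : Finset V → ℝ) (τ : Finset V) (γ : ℝ) : Prop :=
  ∀ g : V → ℝ,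
    (∑ v ∈ linkVerts X τ, w (insert v τ) * g v) = 0 →
    (∑ v ∈ linkVerts X τ, ∑ x ∈ linkVerts X τ,
        if v ≠ x ∧ insert x (insert v τ) ∈ X then
          w (insert v τ) *
            (w (insert x (insert v τ)) / ((τ.card + 2 : ℝ) * w (insert v τ))) * g v * g x
        else 0)
      ≤ γ * ∑ v ∈ linkVerts X τ, w (insert v τ) * g v ^ 2

/-- The down-up walk `W⁻_k` on `X(k)`. -/
noncomputable def downUp {V : Type*} [Fintype V] [DecidableEq V]
    (X : Finset (Finset V)) (w : Finset V → ℝ) (k : ℕ)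
    (f : Finset V → ℝ) (σ : Finset V) : ℝ :=
  ∑ τ ∈ X.filter (fun τ => τ.card = k ∧ τ ⊆ σ),
    (1 / (k + 1 : ℝ)) *
      ∑ σ' ∈ X.filter (fun σ' => σ'.card = k + 1 ∧ τ ⊆ σ'),
        (w σ' / ((k + 1 : ℝ) * w τ)) * f σ'

section WeightedComplex

variable {V : Type*}

/-- The faces with exactly `m` elements. -/
def facesOfCard (X : Finset (Finset V)) (m : ℕ) : Finset (Finset V) :=
  X.filter fun σ => σ.card = m

theorem mem_facesOfCard {X : Finset (Finset V)} {m : ℕ} {σ : Finset V} :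
    σ ∈ facesOfCard X m ↔ σ ∈ X ∧ σ.card = m := by
  simp [facesOfCard]

/-- A bound on a symmetric form over mean-zero functions extends to all functions, the mean
being treated separately. -/
theorem sum_sum_le_of_mean_zero_bound {S : Finset V} {b : V → V → ℝ} {p : V → ℝ} {γ : ℝ}
    (hsymm : ∀ v x, b v x = b x v) (hrow : ∀ v ∈ S, ∑ x ∈ S, b v x = p v)
    (hgap : ∀ g : V → ℝ, ∑ v ∈ S, p v * g v = 0 →
      ∑ v ∈ S, ∑ x ∈ S, b v x * g v * g x ≤ γ * ∑ v ∈ S, p v * g v ^ 2)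
    (g : V → ℝ) {c : ℝ} (hc : (∑ v ∈ S, p v) * c = ∑ v ∈ S, p v * g v) :
    ∑ v ∈ S, ∑ x ∈ S, b v x * g v * g x ≤
      γ * ∑ v ∈ S, p v * g v ^ 2 + (1 - γ) * ((∑ v ∈ S, p v) * c ^ 2) := by
  have h0 : ∑ v ∈ S, p v * (g v - c) = 0 := by
    simp only [mul_sub, sum_sub_distrib, ← sum_mul, hc, sub_self]
  have hrow_g : ∑ v ∈ S, ∑ x ∈ S, b v x * g v = ∑ v ∈ S, p v * g v :=
    sum_congr rfl fun v hv => by rw [← sum_mul, hrow v hv]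
  have hcol_g : ∑ v ∈ S, ∑ x ∈ S, b v x * g x = ∑ v ∈ S, p v * g v := by
    rw [sum_comm, ← hrow_g]
    exact sum_congr rfl fun v _ => sum_congr rfl fun x _ => by rw [hsymm]
  have htot : ∑ v ∈ S, ∑ x ∈ S, b v x = ∑ v ∈ S, p v := sum_congr rfl hrow
  have hform : ∑ v ∈ S, ∑ x ∈ S, b v x * (g v - c) * (g x - c) =
      ∑ v ∈ S, ∑ x ∈ S, b v x * g v * g x - c * ∑ v ∈ S, ∑ x ∈ S, b v x * g v
        - c * ∑ v ∈ S, ∑ x ∈ S, b v x * g x + c ^ 2 * ∑ v ∈ S, ∑ x ∈ S, b v x := by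
    simp only [mul_sum, ← sum_sub_distrib, ← sum_add_distrib]
    exact sum_congr rfl fun v _ => sum_congr rfl fun x _ => by ring
  have hnorm : ∑ v ∈ S, p v * (g v - c) ^ 2 =
      ∑ v ∈ S, p v * g v ^ 2 - 2 * c * ∑ v ∈ S, p v * g v + c ^ 2 * ∑ v ∈ S, p v := by
    simp only [mul_sum, ← sum_sub_distrib, ← sum_add_distrib]
    exact sum_congr rfl fun v _ => by ring
  have h := hgap (fun v => g v - c) h0
  rw [hform, hnorm, hrow_g, hcol_g, htot, ← hc] at h
  linarith

variable [DecidableEq V]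

theorem sum_facets_eq_sum_erase {X : Finset (Finset V)}
    (hdown : ∀ σ ∈ X, ∀ τ ⊆ σ, τ ∈ X) {m : ℕ} {σ : Finset V}
    (hσ : σ ∈ facesOfCard X (m + 1)) (F : Finset V → ℝ) :
    ∑ τ ∈ X.filter (fun τ => τ.card = m ∧ τ ⊆ σ), F τ = ∑ v ∈ σ, F (σ.erase v) := by
  obtain ⟨hX, hc⟩ := mem_facesOfCard.1 hσ
  symm
  refine Finset.sum_bij (fun v _ => σ.erase v) ?_ ?_ ?_ ?_
  · intro v hv
    simp [hdown σ hX _ (erase_subset v σ), card_erase_of_mem hv, hc, erase_subset]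
  · intro v hv x hx h
    exact (erase_inj σ hv).1 h
  · intro τ hτ
    obtain ⟨hτX, hτc, hs⟩ := by simpa using hτ
    obtain ⟨v, hv, rfl⟩ := (covBy_iff_exists_insert.1 (covBy_iff_card_sdiff_eq_one.2
      ⟨hs, by rw [card_sdiff_of_subset hs]; omega⟩))
    exact ⟨v, mem_insert_self v τ, erase_insert hv⟩
  · simp

variable [Fintype V]

theorem mem_linkVerts {X : Finset (Finset V)} {τ : Finset V} {v : V} :
    v ∈ linkVerts X τ ↔ v ∉ τ ∧ insert v τ ∈ X := by
  simp [linkVerts]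

/-- The averaging operator from functions on `m`-element faces to functions on
`(m+1)`-element faces. -/
noncomputable def upAvg (m : ℕ) (g : Finset V → ℝ) (σ : Finset V) : ℝ :=
  (1 / (m + 1 : ℝ)) * ∑ v ∈ σ, g (σ.erase v)

/-- The averaging operator from functions on `(m+1)`-element faces to functions on
`m`-element faces. -/
noncomputable def downAvg (X : Finset (Finset V)) (w : Finset V → ℝ) (m : ℕ)
    (f : Finset V → ℝ) (τ : Finset V) : ℝ :=
  (1 / ((m + 1 : ℝ) * w τ)) * ∑ v ∈ linkVerts X τ, w (insert v τ) * f (insert v τ)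

theorem sum_cofaces_eq_sum_linkVerts (X : Finset (Finset V)) (τ : Finset V)
    (F : Finset V → ℝ) :
    ∑ σ ∈ X.filter (fun σ => σ.card = τ.card + 1 ∧ τ ⊆ σ), F σ =
      ∑ v ∈ linkVerts X τ, F (insert v τ) := by
  symm
  refine Finset.sum_bij (fun v _ => insert v τ) ?_ ?_ ?_ ?_
  · intro v hv
    obtain ⟨hv, hX⟩ := mem_linkVerts.1 hv
    simp [hX, card_insert_of_notMem hv]
  · intro v hv x hx h
    exact (insert_inj (mem_linkVerts.1 hv).1).1 h
  · intro σ hσ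
    obtain ⟨hX, hc, hs⟩ := by simpa using hσ
    obtain ⟨v, hv, rfl⟩ := (covBy_iff_exists_insert.1 (covBy_iff_card_sdiff_eq_one.2
      ⟨hs, by rw [card_sdiff_of_subset hs]; omega⟩))
    exact ⟨v, mem_linkVerts.2 ⟨hv, hX⟩, rfl⟩
  · simp

/-- Double counting of pairs of a face and one of its vertices. -/
theorem sum_faces_sum_mem {X : Finset (Finset V)}
    (hdown : ∀ σ ∈ X, ∀ τ ⊆ σ, τ ∈ X) (m : ℕ) (F : Finset V → V → ℝ) :
    ∑ σ ∈ facesOfCard X (m + 1), ∑ v ∈ σ, F σ v =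
      ∑ τ ∈ facesOfCard X m, ∑ v ∈ linkVerts X τ, F (insert v τ) v := by
  rw [Finset.sum_sigma', Finset.sum_sigma']
  refine Finset.sum_bij' (fun p _ => ⟨p.1.erase p.2, p.2⟩)
    (fun p _ => ⟨insert p.2 p.1, p.2⟩) ?_ ?_ ?_ ?_ ?_
  · rintro ⟨σ, v⟩ h
    simp only [mem_sigma, mem_facesOfCard, mem_linkVerts] at h ⊢
    obtain ⟨⟨hX, hc⟩, hv⟩ := h
    refine ⟨⟨hdown σ hX _ (erase_subset v σ), by rw [card_erase_of_mem hv, hc]; rfl⟩,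
      notMem_erase v σ, by rwa [insert_erase hv]⟩
  · rintro ⟨τ, v⟩ h
    simp only [mem_sigma, mem_facesOfCard, mem_linkVerts] at h ⊢
    obtain ⟨⟨hX, hc⟩, hv, hvX⟩ := h
    exact ⟨⟨hvX, by rw [card_insert_of_notMem hv, hc]⟩, mem_insert_self v τ⟩
  · rintro ⟨σ, v⟩ h
    simp only [mem_sigma] at h
    simp [insert_erase h.2]
  · rintro ⟨τ, v⟩ h
    simp only [mem_sigma, mem_linkVerts] at h
    simp [erase_insert h.2.1]
  · rintro ⟨σ, v⟩ h
    simp only [mem_sigma] at h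
    simp [insert_erase h.2]

theorem downUp_eq_upAvg_downAvg {X : Finset (Finset V)}
    (hdown : ∀ σ ∈ X, ∀ τ ⊆ σ, τ ∈ X) (w : Finset V → ℝ) {k : ℕ} (f : Finset V → ℝ)
    {σ : Finset V} (hσ : σ ∈ facesOfCard X (k + 1)) :
    downUp X w k f σ = upAvg k (downAvg X w k f) σ := by
  rw [upAvg, mul_sum, ← sum_facets_eq_sum_erase hdown hσ fun τ =>
    (1 / (k + 1 : ℝ)) * downAvg X w k f τ, downUp]
  refine sum_congr rfl fun τ hτ => ?_
  obtain ⟨-, rfl, -⟩ := by simpa using hτ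
  rw [sum_cofaces_eq_sum_linkVerts, downAvg]
  congr 1
  rw [mul_sum]
  refine sum_congr rfl fun v _ => ?_
  ring

theorem sum_mul_upAvg_mul {X : Finset (Finset V)}
    (hdown : ∀ σ ∈ X, ∀ τ ⊆ σ, τ ∈ X) {w : Finset V → ℝ} (hw : ∀ σ ∈ X, 0 < w σ)
    (m : ℕ) (g f : Finset V → ℝ) :
    ∑ σ ∈ facesOfCard X (m + 1), w σ * upAvg m g σ * f σ =
      ∑ τ ∈ facesOfCard X m, w τ * g τ * downAvg X w m f τ := by
  have h := sum_faces_sum_mem hdown m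
    fun σ v => (1 / (m + 1 : ℝ)) * (w σ * g (σ.erase v) * f σ)
  refine Eq.trans ?_ (h.trans ?_)
  · refine sum_congr rfl fun σ _ => ?_
    rw [upAvg, mul_sum, mul_sum, sum_mul]
    exact sum_congr rfl fun v _ => by ring
  · refine sum_congr rfl fun τ hτ => ?_
    have := (hw τ (mem_facesOfCard.1 hτ).1).ne'
    rw [downAvg, mul_sum, mul_sum]
    refine sum_congr rfl fun v hv => ?_
    rw [erase_insert (mem_linkVerts.1 hv).1]
    field_simp

theorem sum_mul_downAvg {X : Finset (Finset V)}
    (hdown : ∀ σ ∈ X, ∀ τ ⊆ σ, τ ∈ X) {w : Finset V → ℝ} (hw : ∀ σ ∈ X, 0 < w σ)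
    (m : ℕ) (f : Finset V → ℝ) :
    ∑ τ ∈ facesOfCard X m, w τ * downAvg X w m f τ =
      ∑ σ ∈ facesOfCard X (m + 1), w σ * f σ := by
  have h := sum_mul_upAvg_mul hdown hw m (fun _ => 1) f
  simp only [mul_one] at h
  rw [← h]
  refine sum_congr rfl fun σ hσ => ?_
  have : (m + 1 : ℝ) ≠ 0 := by positivity
  simp [upAvg, (mem_facesOfCard.1 hσ).2, this]

theorem linkVerts_insert {X : Finset (Finset V)}
    (hdown : ∀ σ ∈ X, ∀ τ ⊆ σ, τ ∈ X) (τ : Finset V) (v : V) :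
    linkVerts X (insert v τ) =
      (linkVerts X τ).filter fun x => v ≠ x ∧ insert x (insert v τ) ∈ X := by
  ext x
  simp only [mem_linkVerts, mem_filter, mem_insert, not_or]
  constructor
  · rintro ⟨⟨hxv, hx⟩, hX⟩
    exact ⟨⟨hx, hdown _ hX _ (insert_subset_insert x (subset_insert v τ))⟩, Ne.symm hxv, hX⟩
  · rintro ⟨⟨hx, -⟩, hvx, hX⟩
    exact ⟨⟨Ne.symm hvx, hx⟩, hX⟩

/-- The weight of a face of cardinality at most `d`, summed over the vertices of its link. -/
theorem sum_linkVerts_weight {X : Finset (Finset V)} {w : Finset V → ℝ} {d : ℕ}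
    (hw_rec : ∀ τ ∈ X, τ.card ≤ d →
      w τ = (1 / (τ.card + 1 : ℝ)) *
        ∑ σ ∈ X.filter (fun σ => σ.card = τ.card + 1 ∧ τ ⊆ σ), w σ)
    {m : ℕ} (hm : m ≤ d) {τ : Finset V} (hτ : τ ∈ facesOfCard X m) :
    ∑ v ∈ linkVerts X τ, w (insert v τ) = (m + 1) * w τ := by
  obtain ⟨hX, rfl⟩ := mem_facesOfCard.1 hτ
  have h := hw_rec τ hX hm
  rw [sum_cofaces_eq_sum_linkVerts] at h
  have : (τ.card + 1 : ℝ) ≠ 0 := by positivity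
  rw [h]
  field_simp

theorem link_form_le {X : Finset (Finset V)}
    (hdown : ∀ σ ∈ X, ∀ τ ⊆ σ, τ ∈ X) {w : Finset V → ℝ} (hw : ∀ σ ∈ X, 0 < w σ) {d : ℕ}
    (hw_rec : ∀ τ ∈ X, τ.card ≤ d →
      w τ = (1 / (τ.card + 1 : ℝ)) *
        ∑ σ ∈ X.filter (fun σ => σ.card = τ.card + 1 ∧ τ ⊆ σ), w σ)
    {n : ℕ} (hn : n + 1 ≤ d) {ρ : Finset V} (hρ : ρ ∈ facesOfCard X n) {γ : ℝ}
    (hgap : lamTwoLe X w ρ γ) (f : Finset V → ℝ) :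
    ∑ v ∈ linkVerts X ρ, ∑ x ∈ linkVerts X (insert v ρ),
        w (insert x (insert v ρ)) * f (insert v ρ) * f (insert x ρ) ≤
      (n + 2) * (γ * ∑ v ∈ linkVerts X ρ, w (insert v ρ) * f (insert v ρ) ^ 2 +
        (1 - γ) * ((n + 1) * (w ρ * downAvg X w n f ρ ^ 2))) := by
  obtain ⟨hρX, hρn⟩ := mem_facesOfCard.1 hρ
  have hn2 : (n + 2 : ℝ) ≠ 0 := by positivity
  have hwρ := (hw ρ hρX).ne'
  have htot := sum_linkVerts_weight hw_rec (by omega : n ≤ d) hρ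
  set b : V → V → ℝ := fun v x =>
    if v ≠ x ∧ insert x (insert v ρ) ∈ X then w (insert x (insert v ρ)) / (n + 2) else 0
    with hb
  have hsymm : ∀ v x, b v x = b x v := fun v x => by
    simp only [hb, insert_comm x v, ne_comm (a := v)]
  have hrow : ∀ v ∈ linkVerts X ρ, ∑ x ∈ linkVerts X ρ, b v x = w (insert v ρ) := by
    intro v hv
    obtain ⟨hvρ, hvX⟩ := mem_linkVerts.1 hv
    rw [← sum_filter, ← linkVerts_insert hdown, ← sum_div,
      sum_linkVerts_weight hw_rec hn
        (mem_facesOfCard.2 ⟨hvX, by rw [card_insert_of_notMem hvρ, hρn]⟩)]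
    push_cast
    field_simp
    ring
  have hform : ∀ g : V → ℝ, ∑ v ∈ linkVerts X ρ, ∑ x ∈ linkVerts X ρ,
      (if v ≠ x ∧ insert x (insert v ρ) ∈ X then
          w (insert v ρ) *
            (w (insert x (insert v ρ)) / ((ρ.card + 2 : ℝ) * w (insert v ρ))) * g v * g x
        else 0) = ∑ v ∈ linkVerts X ρ, ∑ x ∈ linkVerts X ρ, b v x * g v * g x := by
    intro g
    refine sum_congr rfl fun v hv => sum_congr rfl fun x _ => ?_
    have := (hw _ (mem_linkVerts.1 hv).2).ne'
    simp only [hb, hρn]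
    split_ifs
    · field_simp
    · ring
  have key := sum_sum_le_of_mean_zero_bound (γ := γ) hsymm hrow
    (fun g hg => hform g ▸ hgap g hg) (fun v => f (insert v ρ)) (c := downAvg X w n f ρ)
    (by rw [htot, downAvg]; field_simp)
  have hexpand : ∑ v ∈ linkVerts X ρ, ∑ x ∈ linkVerts X (insert v ρ),
        w (insert x (insert v ρ)) * f (insert v ρ) * f (insert x ρ) =
      (n + 2) * ∑ v ∈ linkVerts X ρ, ∑ x ∈ linkVerts X ρ,
        b v x * f (insert v ρ) * f (insert x ρ) := by
    rw [mul_sum]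
    refine sum_congr rfl fun v _ => ?_
    rw [linkVerts_insert hdown, sum_filter, mul_sum]
    refine sum_congr rfl fun x _ => ?_
    simp only [hb]
    split_ifs
    · field_simp
    · ring
  rw [hexpand]
  refine mul_le_mul_of_nonneg_left ?_ (by positivity)
  rw [htot] at key
  linarith

/-- The norm of `upAvg`, split into the diagonal part and the forms on the links. -/
theorem sum_mul_upAvg_sq {X : Finset (Finset V)}
    (hdown : ∀ σ ∈ X, ∀ τ ⊆ σ, τ ∈ X) {w : Finset V → ℝ} {d : ℕ}
    (hw_rec : ∀ τ ∈ X, τ.card ≤ d →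
      w τ = (1 / (τ.card + 1 : ℝ)) *
        ∑ σ ∈ X.filter (fun σ => σ.card = τ.card + 1 ∧ τ ⊆ σ), w σ)
    {n : ℕ} (hn : n + 1 ≤ d) (g : Finset V → ℝ) :
    (n + 2 : ℝ) ^ 2 * ∑ σ ∈ facesOfCard X (n + 2), w σ * upAvg (n + 1) g σ ^ 2 =
      (n + 2) * ∑ τ ∈ facesOfCard X (n + 1), w τ * g τ ^ 2 +
      ∑ ρ ∈ facesOfCard X n, ∑ v ∈ linkVerts X ρ, ∑ x ∈ linkVerts X (insert v ρ),
        w (insert x (insert v ρ)) * g (insert v ρ) * g (insert x ρ) := by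
  have hsplit : (n + 2 : ℝ) ^ 2 * ∑ σ ∈ facesOfCard X (n + 2), w σ * upAvg (n + 1) g σ ^ 2 =
      ∑ σ ∈ facesOfCard X (n + 1 + 1), ∑ v ∈ σ, (w σ * g (σ.erase v) ^ 2 +
        ∑ x ∈ σ.erase v, w σ * g (σ.erase v) * g (σ.erase x)) := by
    rw [mul_sum]
    refine sum_congr rfl fun σ _ => ?_
    have h1 : (n + 2 : ℝ) ^ 2 * (w σ * upAvg (n + 1) g σ ^ 2) =
        ∑ v ∈ σ, ∑ x ∈ σ, w σ * g (σ.erase v) * g (σ.erase x) := by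
      simp only [← mul_sum, ← sum_mul]
      rw [upAvg]
      push_cast
      have : (n + 1 + 1 : ℝ) ≠ 0 := by positivity
      field_simp
      ring
    rw [h1]
    refine sum_congr rfl fun v hv => ?_
    rw [← add_sum_erase σ _ hv]
    ring
  rw [hsplit, sum_faces_sum_mem hdown]
  simp only [sum_add_distrib]
  congr 1
  · rw [mul_sum]
    refine sum_congr rfl fun τ hτ => ?_
    have h := sum_linkVerts_weight hw_rec hn hτ
    push_cast at h
    rw [← mul_assoc, show (n + 2 : ℝ) = n + 1 + 1 by ring, ← h, sum_mul]
    refine sum_congr rfl fun v hv => ?_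
    rw [erase_insert (mem_linkVerts.1 hv).1]
  · have hswap : ∀ τ ∈ facesOfCard X (n + 1), ∑ v ∈ linkVerts X τ,
        ∑ x ∈ (insert v τ).erase v, w (insert v τ) * g ((insert v τ).erase v) *
          g ((insert v τ).erase x) =
        ∑ x ∈ τ, ∑ v ∈ linkVerts X τ, w (insert v τ) * g τ * g ((insert v τ).erase x) := by
      intro τ _
      rw [sum_comm]
      refine sum_congr rfl fun v hv => ?_
      rw [erase_insert (mem_linkVerts.1 hv).1]
    rw [sum_congr rfl hswap, sum_faces_sum_mem hdown]
    refine sum_congr rfl fun ρ _ => sum_congr rfl fun v hv => sum_congr rfl fun x hx => ?_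
    have hx' := (mem_linkVerts.1 hx).1
    rw [mem_insert, not_or] at hx'
    rw [insert_comm x v, erase_insert]
    rw [mem_insert, not_or]
    exact ⟨Ne.symm hx'.1, (mem_linkVerts.1 hv).1⟩

/-- Passing the bound for `upAvg` to its adjoint `downAvg`. -/
theorem sum_mul_downAvg_sq_le_of_upAvg {X : Finset (Finset V)}
    (hdown : ∀ σ ∈ X, ∀ τ ⊆ σ, τ ∈ X) {w : Finset V → ℝ} (hw : ∀ σ ∈ X, 0 < w σ)
    {m : ℕ} {c : ℝ} (hc : 0 ≤ c) (f : Finset V → ℝ)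
    (hup : ∑ σ ∈ facesOfCard X (m + 1), w σ * upAvg m (downAvg X w m f) σ ^ 2 ≤
      c * ∑ τ ∈ facesOfCard X m, w τ * downAvg X w m f τ ^ 2) :
    ∑ τ ∈ facesOfCard X m, w τ * downAvg X w m f τ ^ 2 ≤
      c * ∑ σ ∈ facesOfCard X (m + 1), w σ * f σ ^ 2 := by
  have hpos : ∀ (l : ℕ) (h : Finset V → ℝ), 0 ≤ ∑ σ ∈ facesOfCard X l, w σ * h σ ^ 2 :=
    fun l h => sum_nonneg fun σ hσ =>
      mul_nonneg (hw σ (mem_facesOfCard.1 hσ).1).le (sq_nonneg _)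
  have hadj := sum_mul_upAvg_mul hdown hw m (downAvg X w m f) f
  have hcs := sum_sq_le_sum_mul_sum_of_sq_le_mul (facesOfCard X (m + 1))
    (r := fun σ => w σ * upAvg m (downAvg X w m f) σ * f σ)
    (f := fun σ => w σ * f σ ^ 2) (g := fun σ => w σ * upAvg m (downAvg X w m f) σ ^ 2)
    (fun σ hσ => mul_nonneg (hw σ (mem_facesOfCard.1 hσ).1).le (sq_nonneg _))
    (fun σ hσ => mul_nonneg (hw σ (mem_facesOfCard.1 hσ).1).le (sq_nonneg _))
    (fun σ _ => le_of_eq (by ring))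
  simp only [mul_assoc, ← pow_two] at hadj hcs
  rw [hadj] at hcs
  have hA := hpos (m + 1) f
  have hB := hpos m (downAvg X w m f)
  set A := ∑ σ ∈ facesOfCard X (m + 1), w σ * f σ ^ 2
  set B := ∑ τ ∈ facesOfCard X m, w τ * downAvg X w m f τ ^ 2
  rcases hB.eq_or_lt with h | h
  · rw [← h]
    exact mul_nonneg hc hA
  · refine le_of_mul_le_mul_right ?_ h
    nlinarith [mul_le_mul_of_nonneg_left hup hA]

theorem sum_mul_downAvg_sq_le {X : Finset (Finset V)}
    (hdown : ∀ σ ∈ X, ∀ τ ⊆ σ, τ ∈ X) {w : Finset V → ℝ} (hw : ∀ σ ∈ X, 0 < w σ) {d : ℕ}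
    (hw_rec : ∀ τ ∈ X, τ.card ≤ d →
      w τ = (1 / (τ.card + 1 : ℝ)) *
        ∑ σ ∈ X.filter (fun σ => σ.card = τ.card + 1 ∧ τ ⊆ σ), w σ)
    {γ : ℕ → ℝ} {k : ℕ} (hkd : k ≤ d) (hγ : ∀ j < k, 0 ≤ γ j ∧ γ j < 1)
    (hexp : ∀ j < k, ∀ τ ∈ X, τ.card = j → lamTwoLe X w τ (γ j))
    {f : Finset V → ℝ} (hf : ∑ σ ∈ facesOfCard X (k + 1), w σ * f σ = 0) :
    ∑ τ ∈ facesOfCard X k, w τ * downAvg X w k f τ ^ 2 ≤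
      (1 - (∏ j ∈ range k, (1 - γ j)) / ((k : ℝ) + 1)) *
        ∑ σ ∈ facesOfCard X (k + 1), w σ * f σ ^ 2 := by
  induction k generalizing f with
  | zero =>
    have hmean := sum_mul_downAvg hdown hw 0 f
    rw [hf] at hmean
    have hempty : ∀ τ ∈ facesOfCard X 0, τ = ∅ := fun τ hτ =>
      card_eq_zero.1 (mem_facesOfCard.1 hτ).2
    have hzero : ∀ τ ∈ facesOfCard X 0, w τ * downAvg X w 0 f τ ^ 2 = 0 := by
      intro τ hτ
      rw [sum_eq_single_of_mem τ hτ fun σ hσ hne =>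
        absurd ((hempty σ hσ).trans (hempty τ hτ).symm) hne] at hmean
      rw [pow_two, ← mul_assoc, hmean, zero_mul]
    rw [sum_eq_zero hzero]
    simp
  | succ n ih =>
    have hn2 : (0 : ℝ) < n + 2 := by positivity
    have hP0 : ∏ j ∈ range (n + 1), (1 - γ j) ≤ 1 :=
      prod_le_one (fun j hj => by linarith [(hγ j (mem_range.1 hj)).2])
        fun j hj => by linarith [(hγ j (mem_range.1 hj)).1]
    refine sum_mul_downAvg_sq_le_of_upAvg hdown hw ?_ f ?_
    · rw [sub_nonneg, div_le_one (by positivity)]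
      push_cast
      linarith [(Nat.cast_nonneg n : (0 : ℝ) ≤ n)]
    set g := downAvg X w (n + 1) f
    have hg : ∑ τ ∈ facesOfCard X (n + 1), w τ * g τ = 0 :=
      (sum_mul_downAvg hdown hw (n + 1) f).trans hf
    have hstep := ih (by omega) (fun j hj => hγ j (by omega)) (fun j hj => hexp j (by omega)) hg
    have hnorm := sum_mul_upAvg_sq hdown hw_rec hkd g
    have hlinks := sum_le_sum fun ρ hρ => link_form_le hdown hw hw_rec hkd hρ
      (hexp n (by omega) ρ (mem_facesOfCard.1 hρ).1 (mem_facesOfCard.1 hρ).2) g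
    have hcount : ∑ ρ ∈ facesOfCard X n, ∑ v ∈ linkVerts X ρ,
        w (insert v ρ) * g (insert v ρ) ^ 2 =
        (n + 1) * ∑ τ ∈ facesOfCard X (n + 1), w τ * g τ ^ 2 := by
      rw [← sum_faces_sum_mem hdown n fun σ _ => w σ * g σ ^ 2, mul_sum]
      refine sum_congr rfl fun σ hσ => ?_
      rw [sum_const, (mem_facesOfCard.1 hσ).2]
      simp
    simp only [← mul_sum, sum_add_distrib] at hlinks
    rw [hcount] at hlinks
    have hγn := hγ n (by omega)
    have hstep' := mul_le_mul_of_nonneg_left hstep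
      (mul_nonneg (sub_nonneg.2 hγn.2.le) (by positivity : (0 : ℝ) ≤ n + 1))
    rw [prod_range_succ]
    push_cast
    set A := ∑ τ ∈ facesOfCard X (n + 1), w τ * g τ ^ 2
    set B := ∑ ρ ∈ facesOfCard X n, w ρ * downAvg X w n g ρ ^ 2
    set P := ∏ j ∈ range n, (1 - γ j)
    have hrhs : (1 - γ n) * (n + 1) * ((1 - P / ((n : ℝ) + 1)) * A) =
        (1 - γ n) * (n + 1 - P) * A := by
      field_simp
    rw [hrhs] at hstep'
    have htarget : (n + 2 : ℝ) ^ 2 * ((1 - P * (1 - γ n) / ((n : ℝ) + 1 + 1)) * A) =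
        (n + 2) * ((n + 2 - P * (1 - γ n)) * A) := by
      have : (n + 1 + 1 : ℝ) ≠ 0 := by positivity
      rw [show (n + 2 : ℝ) = n + 1 + 1 by ring]
      field_simp
    refine le_of_mul_le_mul_left ?_ (pow_pos hn2 2)
    rw [htarget, hnorm]
    have hstep'' := mul_le_mul_of_nonneg_left hstep' hn2.le
    linarith

end WeightedComplex

/-- **Rapid mixing for weak local spectral expanders, Alev–Lau.**
Let `(X,w)` be a pure `d`-dimensional weighted simplicial complex, `1 ≤ k ≤ d`, and let
`γ j ∈ [0,1)` bound `λ₂(A_τ)` for every face `τ` of cardinality `j` (i.e. `τ ∈ X(j-1)`,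
for `j = 0,…,k-1`, corresponding to dimensions `-1,…,k-2`).  Then
`λ₂(W⁻_k) ≤ 1 - (∏_{j<k} (1-γ j)) / (k+1)`. -/
theorem alev_lau_rapid_mixing {V : Type*} [Fintype V] [DecidableEq V] (d : ℕ)
    (X : Finset (Finset V))
    (hdown : ∀ σ ∈ X, ∀ τ ⊆ σ, τ ∈ X)
    (hpure : ∀ σ ∈ X, (∀ ρ ∈ X, σ ⊆ ρ → σ = ρ) → σ.card = d + 1)
    (w : Finset V → ℝ)
    (hw_pos : ∀ σ ∈ X, 0 < w σ)
    (hw_top : ∑ σ ∈ X.filter (fun σ => σ.card = d + 1), w σ = 1)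
    (hw_rec : ∀ τ ∈ X, τ.card ≤ d →
      w τ = (1 / (τ.card + 1 : ℝ)) *
        ∑ σ ∈ X.filter (fun σ => σ.card = τ.card + 1 ∧ τ ⊆ σ), w σ)
    (k : ℕ) (hk1 : 1 ≤ k) (hkd : k ≤ d)
    (γ : ℕ → ℝ)
    (hγ : ∀ j < k, 0 ≤ γ j ∧ γ j < 1)
    (hexp : ∀ j < k, ∀ τ ∈ X, τ.card = j → lamTwoLe X w τ (γ j))
    (f : Finset V → ℝ)
    (hf : ∑ σ ∈ X.filter (fun σ => σ.card = k + 1), w σ * f σ = 0) :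
    ∑ σ ∈ X.filter (fun σ => σ.card = k + 1), w σ * downUp X w k f σ * f σ ≤
      (1 - (∏ j ∈ Finset.range k, (1 - γ j)) / ((k : ℝ) + 1)) *
        ∑ σ ∈ X.filter (fun σ => σ.card = k + 1), w σ * f σ ^ 2 := by
  have hadj := sum_mul_upAvg_mul hdown hw_pos k (downAvg X w k f) f
  have hbound := sum_mul_downAvg_sq_le hdown hw_pos hw_rec hkd hγ hexp hf
  refine le_trans (le_of_eq ?_) hbound
  refine (sum_congr rfl fun σ hσ => ?_).trans
    (hadj.trans (sum_congr rfl fun τ _ => by ring))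
  rw [downUp_eq_upAvg_downAvg hdown w f hσ]
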